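/- arXiv:1810.09214 — 6 statements merged into one kernel-verified Lean document; each statement's English description precedes it below -/
import Mathlib

section
/- Fix τ ∈ (0,1) and u ∈ ℝ, and define r(t) = ρ_τ(u − t) − ρ_τ(u) + 2·t·ψ_τ(u)·u. Then for every t ∈ ℝ, min(τ, 1−τ)·t² ≤ r(t) ≤ max(τ, 1−τ)·t²; in particular 0 ≤ r(t) ≤ t², so r(t) = O(t²) uniformly in u. -/
/-- The check weight `ψ_τ(t) = 1 − τ` if `t ≤ 0`, and `τ` if `t > 0`. -/
noncomputable def psi (τ t : ℝ) : ℝ := if t ≤ 0 then 1 - τ else τ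

/-- The asymmetric squared loss `ρ_τ(t) = ψ_τ(t) · t²`. -/
noncomputable def rho (τ t : ℝ) : ℝ := psi τ t * t ^ 2

/-- The remainder `r(t) = ρ_τ(u − t) − ρ_τ(u) + 2·t·ψ_τ(u)·u`. -/
noncomputable def rRem (τ u t : ℝ) : ℝ := rho τ (u - t) - rho τ u + 2 * t * psi τ u * u

/-- The remainder is a split of `t²` weighted by `τ` and `1 - τ`. -/
lemma rRem_split (τ u t : ℝ) :
    ∃ x y : ℝ, 0 ≤ x ∧ 0 ≤ y ∧ x + y = t ^ 2 ∧ rRem τ u t = τ * x + (1 - τ) * y := by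
  unfold rRem rho psi
  by_cases h1 : u ≤ 0 <;> by_cases h2 : u - t ≤ 0
  · exact ⟨0, t ^ 2, le_refl _, sq_nonneg _, by ring, by simp only [h1, h2, if_true]; ring⟩
  · refine ⟨(u - t) ^ 2, t ^ 2 - (u - t) ^ 2, sq_nonneg _, ?_, by ring,
      by simp only [h1, h2, if_true, if_false]; ring⟩
    nlinarith
  · refine ⟨t ^ 2 - (u - t) ^ 2, (u - t) ^ 2, ?_, sq_nonneg _, by ring,
      by simp only [h1, h2, if_true, if_false]; ring⟩
    nlinarith
  · exact ⟨t ^ 2, 0, sq_nonneg _, le_refl _, by ring, by simp only [h1, h2, if_false]; ring⟩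

/-- For every `t`, `min(τ, 1−τ)·t² ≤ r(t) ≤ max(τ, 1−τ)·t²`; in particular
`0 ≤ r(t) ≤ t²`, so `r(t) = O(t²)` uniformly in `u`. -/
theorem remainder_bounds (τ u : ℝ) (hτ : τ ∈ Set.Ioo (0 : ℝ) 1) (t : ℝ) :
    min τ (1 - τ) * t ^ 2 ≤ rRem τ u t ∧ rRem τ u t ≤ max τ (1 - τ) * t ^ 2 ∧
    0 ≤ rRem τ u t ∧ rRem τ u t ≤ t ^ 2 := by
  obtain ⟨h0, h1⟩ := hτ
  obtain ⟨x, y, hx, hy, hxy, hr⟩ := rRem_split τ u t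
  rw [hr, ← hxy]
  have a1 := mul_le_mul_of_nonneg_right (min_le_left τ (1 - τ)) hx
  have a2 := mul_le_mul_of_nonneg_right (min_le_right τ (1 - τ)) hy
  have b1 := mul_le_mul_of_nonneg_right (le_max_left τ (1 - τ)) hx
  have b2 := mul_le_mul_of_nonneg_right (le_max_right τ (1 - τ)) hy
  refine ⟨by linarith, by linarith, ?_, ?_⟩ <;> nlinarith
end

section
/- Let τ ∈ (0,1) and let P be a Borel probability measure on ℝ with ∫ y² dP(y) < ∞. Then the function G(θ) = ∫ ρ_τ(y − θ) dP(y) is finite for every θ ∈ ℝ and is differentiable on ℝ with derivative G′(θ) = −2 ∫ ψ_τ(y − θ)·(y − θ) dP(y). -/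
open MeasureTheory

theorem psi_bound {τ : ℝ} (hτ : τ ∈ Set.Ioo (0 : ℝ) 1) (t : ℝ) : 0 ≤ psi τ t ∧ psi τ t ≤ 1 := by
  obtain ⟨h0, h1⟩ := hτ
  unfold psi
  split_ifs <;> constructor <;> linarith

theorem psi_measurable (τ : ℝ) : Measurable (psi τ) := by
  unfold psi
  exact Measurable.ite measurableSet_Iic measurable_const measurable_const

theorem rho_hasDerivAt (τ t : ℝ) : HasDerivAt (rho τ) (2 * (psi τ t * t)) t := by
  have hq : ∀ c t : ℝ, HasDerivAt (fun x : ℝ => c * x ^ 2) (2 * (c * t)) t := by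
    intro c t
    have := (hasDerivAt_pow 2 t).const_mul c
    refine this.congr_deriv ?_
    simp only [Nat.cast_ofNat, Nat.add_one_sub_one, pow_one]
    ring
  rcases lt_trichotomy t 0 with h | h | h
  · have e : psi τ t = 1 - τ := if_pos h.le
    rw [e]
    refine (hq (1 - τ) t).congr_of_eventuallyEq ?_
    filter_upwards [Iio_mem_nhds h] with x hx
    simp [rho, psi, (Set.mem_Iio.1 hx).le]
  · subst h
    have h1 : HasDerivWithinAt (rho τ) 0 (Set.Iic 0) 0 := by
      have := (hq (1 - τ) 0).hasDerivWithinAt (s := Set.Iic 0)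
      rw [mul_zero, mul_zero] at this
      refine this.congr (fun x hx => ?_) (by simp [rho])
      simp [rho, psi, Set.mem_Iic.1 hx]
    have h2 : HasDerivWithinAt (rho τ) 0 (Set.Ici 0) 0 := by
      have := (hq τ 0).hasDerivWithinAt (s := Set.Ici 0)
      rw [mul_zero, mul_zero] at this
      refine this.congr (fun x hx => ?_) (by simp [rho])
      rcases eq_or_lt_of_le (Set.mem_Ici.1 hx) with h | h
      · simp [rho, ← h]
      · simp [rho, psi, not_le.2 h]
    have := h1.union h2
    rw [Set.Iic_union_Ici, hasDerivWithinAt_univ] at this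
    simpa using this
  · have e : psi τ t = τ := if_neg (not_le.2 h)
    rw [e]
    refine (hq τ t).congr_of_eventuallyEq ?_
    filter_upwards [Ioi_mem_nhds h] with x hx
    simp [rho, psi, not_le.2 (Set.mem_Ioi.1 hx)]

/-- If `P` is a Borel probability measure on `ℝ` with finite second moment, then
`G(θ) = ∫ ρ_τ(y − θ) dP(y)` is finite for every `θ` and differentiable with
`G′(θ) = −2 ∫ ψ_τ(y − θ)·(y − θ) dP(y)`. -/
theorem expectile_loss_integrable_and_hasDerivAt (τ : ℝ) (hτ : τ ∈ Set.Ioo (0 : ℝ) 1)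
    (P : Measure ℝ) [IsProbabilityMeasure P]
    (hP : Integrable (fun y : ℝ => y ^ 2) P) :
    (∀ θ : ℝ, Integrable (fun y : ℝ => rho τ (y - θ)) P) ∧
    (∀ θ : ℝ, HasDerivAt (fun θ : ℝ => ∫ y, rho τ (y - θ) ∂P)
      (-2 * ∫ y, psi τ (y - θ) * (y - θ) ∂P) θ) := by
  have hm : ∀ θ : ℝ, Measurable (fun y : ℝ => psi τ (y - θ)) := fun θ =>
    (psi_measurable τ).comp (measurable_id.sub_const θ)
  have hrm : ∀ θ : ℝ, Measurable (fun y : ℝ => rho τ (y - θ)) := fun θ =>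
    (hm θ).mul ((measurable_id.sub_const θ).pow_const 2)
  have hI : ∀ θ : ℝ, Integrable (fun y : ℝ => rho τ (y - θ)) P := by
    intro θ
    refine ((hP.const_mul 2).add (integrable_const (2 * θ ^ 2))).mono'
      (hrm θ).aestronglyMeasurable (Filter.Eventually.of_forall fun y => ?_)
    obtain ⟨h0, h1⟩ := psi_bound hτ (y - θ)
    have h2 : 0 ≤ (y - θ) ^ 2 := sq_nonneg _
    simp only [rho, Pi.add_apply, Real.norm_eq_abs]
    rw [abs_of_nonneg (mul_nonneg h0 h2)]
    nlinarith [sq_nonneg (y + θ)]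
  refine ⟨hI, fun θ => ?_⟩
  have key := hasDerivAt_integral_of_dominated_loc_of_deriv_le (μ := P)
    (F := fun θ y => rho τ (y - θ)) (F' := fun θ y => -2 * (psi τ (y - θ) * (y - θ)))
    (x₀ := θ) (s := Metric.ball θ 1) (bound := fun y => 2 * y ^ 2 + 2 * (2 + |θ|))
    (Metric.ball_mem_nhds θ one_pos)
    (Filter.Eventually.of_forall fun x => (hrm x).aestronglyMeasurable) (hI θ)
    (((hm θ).mul (measurable_id.sub_const θ)).const_mul (-2)).aestronglyMeasurable
    (Filter.Eventually.of_forall fun y x hx => ?_)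
    ((hP.const_mul 2).add (integrable_const _))
    (Filter.Eventually.of_forall fun y x hx => ?_)
  · have := key.2
    rwa [integral_const_mul] at this
  · obtain ⟨h0, h1⟩ := psi_bound hτ (y - x)
    rw [Metric.mem_ball, Real.dist_eq] at hx
    have h2 : |y - x| ≤ y ^ 2 + (2 + |θ|) := by
      have a1 : |y| ≤ y ^ 2 + 1 := by nlinarith [sq_abs y, sq_nonneg (|y| - 1), abs_nonneg y]
      have a2 : |y - x| ≤ |y| + |x| := abs_sub y x
      have a3 : |x| ≤ |x - θ| + |θ| := by simpa using abs_add_le (x - θ) θ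
      linarith
    rw [Real.norm_eq_abs, abs_mul, abs_mul, abs_of_nonneg h0]
    have h3 : |(-2 : ℝ)| = 2 := by norm_num
    rw [h3]
    nlinarith [abs_nonneg (y - x)]
  · have := (rho_hasDerivAt τ (y - x)).comp x ((hasDerivAt_id x).const_sub y)
    refine HasDerivAt.congr_deriv this ?_
    ring
end

section
/- Let τ ∈ (0,1), let p, n ≥ 1, and let y_1, …, y_n ∈ ℝ and x_1, …, x_n ∈ ℝ^p be such that the vectors x_1, …, x_n span ℝ^p. Then the expectile regression objective β ↦ ∑_{i=1}^n ρ_τ(y_i − ⟪x_i, β⟫) is strictly convex on ℝ^p, tends to +∞ as ‖β‖ → ∞, and attains its minimum over ℝ^p at exactly one point β̂_τ. -/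
open scoped RealInnerProductSpace

lemma rho_eq (τ t : ℝ) : rho τ t = τ * (max t 0) ^ 2 + (1 - τ) * (max (-t) 0) ^ 2 := by
  unfold rho psi
  split_ifs with h
  · rw [max_eq_right h, max_eq_left (by linarith)]; ring
  · push Not at h
    rw [max_eq_left h.le, max_eq_right (by linarith)]; ring

lemma rho_continuous (τ : ℝ) : Continuous (rho τ) := by
  have : rho τ = fun t => τ * (max t 0) ^ 2 + (1 - τ) * (max (-t) 0) ^ 2 := funext (rho_eq τ)
  rw [this]
  fun_prop

lemma rho_lower (τ : ℝ) (t : ℝ) : min τ (1 - τ) * t ^ 2 ≤ rho τ t := by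
  unfold rho psi
  apply mul_le_mul_of_nonneg_right _ (sq_nonneg t)
  split_ifs
  · exact min_le_right _ _
  · exact min_le_left _ _

lemma sq_max_convex (s t a b : ℝ) (ha : 0 ≤ a) (hb : 0 ≤ b) (hab : a + b = 1) :
    (max (a * s + b * t) 0) ^ 2 ≤ a * (max s 0) ^ 2 + b * (max t 0) ^ 2 := by
  have h1 : max (a * s + b * t) 0 ≤ a * max s 0 + b * max t 0 := by
    apply max_le
    · exact add_le_add (mul_le_mul_of_nonneg_left (le_max_left _ _) ha)
        (mul_le_mul_of_nonneg_left (le_max_left _ _) hb)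
    · positivity
  have h2 : (max (a * s + b * t) 0) ^ 2 ≤ (a * max s 0 + b * max t 0) ^ 2 :=
    pow_le_pow_left₀ (le_max_right _ _) h1 2
  have hb' : b = 1 - a := by linarith
  have h3 : 0 ≤ a * b * (max s 0 - max t 0) ^ 2 := by positivity
  subst hb'
  nlinarith

lemma sq_eq_max (t : ℝ) : t ^ 2 = (max t 0) ^ 2 + (max (-t) 0) ^ 2 := by
  rcases le_total t 0 with h | h
  · rw [max_eq_right h, max_eq_left (by linarith)]; ring
  · rw [max_eq_left h, max_eq_right (by linarith)]; ring

lemma rho_strong (τ : ℝ) (s t a b : ℝ) (ha : 0 ≤ a) (hb : 0 ≤ b) (hab : a + b = 1) :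
    rho τ (a * s + b * t) + min τ (1 - τ) * (a * b * (s - t) ^ 2)
      ≤ a * rho τ s + b * rho τ t := by
  have key : ∀ u, rho τ u = min τ (1 - τ) * u ^ 2 + (τ - min τ (1 - τ)) * (max u 0) ^ 2
      + (1 - τ - min τ (1 - τ)) * (max (-u) 0) ^ 2 := by
    intro u; rw [rho_eq, sq_eq_max u]; ring
  have h1 := mul_le_mul_of_nonneg_left (sq_max_convex s t a b ha hb hab)
    (sub_nonneg.2 (min_le_left τ (1 - τ)))
  have h2 := mul_le_mul_of_nonneg_left (sq_max_convex (-s) (-t) a b ha hb hab)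
    (sub_nonneg.2 (min_le_right τ (1 - τ)))
  have h3 : a * -s + b * -t = -(a * s + b * t) := by ring
  rw [h3] at h2
  rw [key, key s, key t]
  have hb' : b = 1 - a := by linarith
  subst hb'
  linarith

/-- If the covariate vectors `x_1, …, x_n` span `ℝ^p`, then the expectile regression
objective is strictly convex, tends to `+∞` as `‖β‖ → ∞`, and attains its minimum
over `ℝ^p` at exactly one point. -/
theorem expectile_regression_objective_strictConvex_coercive_uniqueMin
    (τ : ℝ) (hτ : τ ∈ Set.Ioo (0 : ℝ) 1)
    (p n : ℕ) (hp : 1 ≤ p) (hn : 1 ≤ n)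
    (y : Fin n → ℝ) (x : Fin n → EuclideanSpace ℝ (Fin p))
    (hx : Submodule.span ℝ (Set.range x) = ⊤) :
    StrictConvexOn ℝ Set.univ
      (fun β : EuclideanSpace ℝ (Fin p) => ∑ i, rho τ (y i - ⟪x i, β⟫)) ∧
    Filter.Tendsto
      (fun β : EuclideanSpace ℝ (Fin p) => ∑ i, rho τ (y i - ⟪x i, β⟫))
      (Bornology.cobounded (EuclideanSpace ℝ (Fin p))) Filter.atTop ∧
    (∃! β : EuclideanSpace ℝ (Fin p), ∀ β' : EuclideanSpace ℝ (Fin p),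
      (∑ i, rho τ (y i - ⟪x i, β⟫)) ≤ ∑ i, rho τ (y i - ⟪x i, β'⟫)) := by
  have hc : 0 < min τ (1 - τ) := lt_min hτ.1 (by linarith [hτ.2])
  have hinj : ∀ v : EuclideanSpace ℝ (Fin p), (∀ i, ⟪x i, v⟫ = 0) → v = 0 := by
    intro v hv
    have h : ∀ w ∈ Submodule.span ℝ (Set.range x), ⟪w, v⟫ = 0 := by
      intro w hw
      induction hw using Submodule.span_induction with
      | mem w hw => obtain ⟨i, rfl⟩ := hw; exact hv i
      | zero => simp
      | add u w _ _ hu hw => rw [inner_add_left, hu, hw, add_zero]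
      | smul r w _ hw => rw [real_inner_smul_left, hw, mul_zero]
    exact inner_self_eq_zero.1 (h v (by rw [hx]; trivial))
  have hconv : StrictConvexOn ℝ Set.univ
      (fun β : EuclideanSpace ℝ (Fin p) => ∑ i, rho τ (y i - ⟪x i, β⟫)) := by
    refine ⟨convex_univ, ?_⟩
    intro u _ v _ huv a b ha hb hab
    have hne : ∃ i, ⟪x i, u - v⟫ ≠ 0 := by
      by_contra! h
      exact huv (sub_eq_zero.1 (hinj _ h))
    have hle : ∀ i, rho τ (y i - ⟪x i, a • u + b • v⟫)
        + min τ (1 - τ) * (a * b * ⟪x i, u - v⟫ ^ 2)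
        ≤ a * rho τ (y i - ⟪x i, u⟫) + b * rho τ (y i - ⟪x i, v⟫) := by
      intro i
      have h := rho_strong τ (y i - ⟪x i, u⟫) (y i - ⟪x i, v⟫) a b ha.le hb.le hab
      have e1 : a * (y i - ⟪x i, u⟫) + b * (y i - ⟪x i, v⟫) = y i - ⟪x i, a • u + b • v⟫ := by
        rw [inner_add_right, real_inner_smul_right, real_inner_smul_right]
        linear_combination (y i) * hab
      have e2 : ((y i - ⟪x i, u⟫) - (y i - ⟪x i, v⟫)) ^ 2 = ⟪x i, u - v⟫ ^ 2 := by
        rw [inner_sub_right]; ring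
      rwa [e1, e2] at h
    simp only [smul_eq_mul, Finset.mul_sum, ← Finset.sum_add_distrib]
    obtain ⟨j, hj⟩ := hne
    apply Finset.sum_lt_sum
    · intro i _
      have : 0 ≤ min τ (1 - τ) * (a * b * ⟪x i, u - v⟫ ^ 2) := by positivity
      linarith [hle i]
    · refine ⟨j, Finset.mem_univ _, ?_⟩
      have : 0 < min τ (1 - τ) * (a * b * ⟪x j, u - v⟫ ^ 2) := by positivity
      linarith [hle j]
  have hcoer : Filter.Tendsto
      (fun β : EuclideanSpace ℝ (Fin p) => ∑ i, rho τ (y i - ⟪x i, β⟫))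
      (Bornology.cobounded (EuclideanSpace ℝ (Fin p))) Filter.atTop := by
    let L : EuclideanSpace ℝ (Fin p) →ₗ[ℝ] (Fin n → ℝ) :=
      LinearMap.pi fun i => (innerₛₗ ℝ (x i))
    have hL : ∀ β i, L β i = ⟪x i, β⟫ := fun β i => rfl
    have hker : LinearMap.ker L = ⊥ := by
      rw [LinearMap.ker_eq_bot']
      intro v hv
      exact hinj v fun i => by rw [← hL, hv]; rfl
    obtain ⟨K, _, hK⟩ := L.exists_antilipschitzWith hker
    have hT : Filter.Tendsto (fun β => ‖L β‖ - ‖y‖)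
        (Bornology.cobounded (EuclideanSpace ℝ (Fin p))) Filter.atTop :=
      Filter.tendsto_atTop_add_const_right _ _
        (tendsto_norm_cobounded_atTop.comp hK.tendsto_cobounded)
    have hT2 := ((Filter.tendsto_pow_atTop (two_ne_zero)).comp hT).const_mul_atTop hc
    refine Filter.tendsto_atTop_mono' _ ?_ hT2
    filter_upwards [hT.eventually_ge_atTop 0] with β hβ
    have h1 : ‖L β‖ - ‖y‖ ≤ ‖y - L β‖ := by
      rw [norm_sub_rev]; exact norm_sub_norm_le _ _
    have h2 : ‖y - L β‖ ≤ √(∑ i, (y i - ⟪x i, β⟫) ^ 2) := by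
      rw [pi_norm_le_iff_of_nonneg (Real.sqrt_nonneg _)]
      intro i
      rw [Real.norm_eq_abs]
      apply Real.abs_le_sqrt
      exact Finset.single_le_sum (f := fun i => (y i - ⟪x i, β⟫) ^ 2)
        (fun i _ => sq_nonneg _) (Finset.mem_univ i)
    have h3 : (‖L β‖ - ‖y‖) ^ 2 ≤ ∑ i, (y i - ⟪x i, β⟫) ^ 2 := by
      rw [← Real.sq_sqrt (Finset.sum_nonneg fun i _ => sq_nonneg (y i - ⟪x i, β⟫))]
      exact pow_le_pow_left₀ hβ (h1.trans h2) 2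
    calc min τ (1 - τ) * (‖L β‖ - ‖y‖) ^ 2
        ≤ min τ (1 - τ) * ∑ i, (y i - ⟪x i, β⟫) ^ 2 := mul_le_mul_of_nonneg_left h3 hc.le
      _ = ∑ i, min τ (1 - τ) * (y i - ⟪x i, β⟫) ^ 2 := Finset.mul_sum _ _ _
      _ ≤ _ := Finset.sum_le_sum fun i _ => rho_lower τ _
  refine ⟨hconv, hcoer, ?_⟩
  have hcont : Continuous
      (fun β : EuclideanSpace ℝ (Fin p) => ∑ i, rho τ (y i - ⟪x i, β⟫)) := by
    refine continuous_finsetSum _ fun i _ => (rho_continuous τ).comp ?_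
    fun_prop
  rw [Metric.cobounded_eq_cocompact] at hcoer
  obtain ⟨β, hβ⟩ := hcont.exists_forall_le hcoer
  refine ⟨β, hβ, fun γ hγ => ?_⟩
  exact hconv.eq_of_isMinOn (fun z _ => hγ z) (fun z _ => hβ z) (Set.mem_univ _) (Set.mem_univ _)
end

section
/- Let τ ∈ (0,1), let p, n ≥ 1, and let y_1, …, y_n ∈ ℝ and x_1, …, x_n ∈ ℝ^p. Then β ∈ ℝ^p minimizes the expectile regression objective β ↦ ∑_{i=1}^n ρ_τ(y_i − ⟪x_i, β⟫) if and only if it solves the expectile estimating equations ∑_{i=1}^n ψ_τ(y_i − ⟪x_i, β⟫)·(y_i − ⟪x_i, β⟫)·x_i = 0 (the zero vector in ℝ^p). -/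
open scoped RealInnerProductSpace

lemma rho_lower_s15 (τ : ℝ) (h0 : 0 < τ) (h1 : τ < 1) (t s : ℝ) :
    rho τ t + 2 * (psi τ t * t) * (s - t) ≤ rho τ s := by
  unfold rho psi
  split_ifs with ht hs hs
  · nlinarith [mul_nonneg (sub_nonneg.2 h1.le) (sq_nonneg (s - t))]
  · have := mul_nonneg (sub_nonneg.2 h1.le) (mul_nonneg (neg_nonneg.2 ht) (not_le.1 hs).le)
    nlinarith [mul_nonneg (sub_nonneg.2 h1.le) (sq_nonneg t), mul_nonneg h0.le (sq_nonneg s)]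
  · have := mul_nonneg h0.le (mul_nonneg (neg_nonneg.2 hs) (not_le.1 ht).le)
    nlinarith [mul_nonneg (sub_nonneg.2 h1.le) (sq_nonneg s), mul_nonneg h0.le (sq_nonneg t)]
  · nlinarith [mul_nonneg h0.le (sq_nonneg (s - t))]

lemma rho_upper (τ : ℝ) (h0 : 0 < τ) (h1 : τ < 1) (t s : ℝ) :
    rho τ s ≤ rho τ t + 2 * (psi τ t * t) * (s - t) + (s - t) ^ 2 := by
  unfold rho psi
  split_ifs with hs ht ht
  · nlinarith [mul_nonneg h0.le (sq_nonneg (s - t))]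
  · have := mul_nonneg (sub_nonneg.2 h1.le) (mul_nonneg (neg_nonneg.2 hs) (not_le.1 ht).le)
    nlinarith [mul_nonneg (sub_nonneg.2 h1.le) (sq_nonneg t), mul_nonneg h0.le (sq_nonneg s)]
  · have := mul_nonneg h0.le (mul_nonneg (neg_nonneg.2 ht) (not_le.1 hs).le)
    nlinarith [mul_nonneg (sub_nonneg.2 h1.le) (sq_nonneg s), mul_nonneg h0.le (sq_nonneg t)]
  · nlinarith [mul_nonneg (sub_nonneg.2 h1.le) (sq_nonneg (s - t))]

/-- `β` minimizes the expectile regression objective iff it solves the expectile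
estimating equations `∑ ψ_τ(y_i − ⟪x_i, β⟫)·(y_i − ⟪x_i, β⟫)·x_i = 0`. -/
theorem expectile_estimating_equations (τ : ℝ) (hτ : τ ∈ Set.Ioo (0 : ℝ) 1)
    (p n : ℕ) (hp : 1 ≤ p) (hn : 1 ≤ n)
    (y : Fin n → ℝ) (x : Fin n → EuclideanSpace ℝ (Fin p))
    (β : EuclideanSpace ℝ (Fin p)) :
    (∀ β' : EuclideanSpace ℝ (Fin p),
        (∑ i, rho τ (y i - ⟪x i, β⟫)) ≤ ∑ i, rho τ (y i - ⟪x i, β'⟫)) ↔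
      ∑ i, (psi τ (y i - ⟪x i, β⟫) * (y i - ⟪x i, β⟫)) • x i = 0 := by
  obtain ⟨h0, h1⟩ := hτ
  have key : ∀ v : EuclideanSpace ℝ (Fin p),
      ⟪∑ i, (psi τ (y i - ⟪x i, β⟫) * (y i - ⟪x i, β⟫)) • x i, v⟫ =
        ∑ i, (psi τ (y i - ⟪x i, β⟫) * (y i - ⟪x i, β⟫)) * ⟪x i, v⟫ := by
    intro v
    rw [sum_inner]
    exact Finset.sum_congr rfl fun i _ => real_inner_smul_left _ _ _
  constructor
  · intro h
    set g := ∑ i, (psi τ (y i - ⟪x i, β⟫) * (y i - ⟪x i, β⟫)) • x i with hg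
    set C := ∑ i, ⟪x i, g⟫ ^ 2 with hC
    have hC0 : 0 ≤ C := Finset.sum_nonneg fun i _ => sq_nonneg _
    have kg := key g
    have main : ∀ ε : ℝ, 0 ≤ -2 * ε * ⟪g, g⟫ + ε ^ 2 * C := by
      intro ε
      have h2 := (h (β + ε • g)).trans (Finset.sum_le_sum fun i _ =>
        rho_upper τ h0 h1 (y i - ⟪x i, β⟫) (y i - ⟪x i, β + ε • g⟫))
      have h3 : ∑ i, (rho τ (y i - ⟪x i, β⟫) + 2 * (psi τ (y i - ⟪x i, β⟫) * (y i - ⟪x i, β⟫)) *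
          ((y i - ⟪x i, β + ε • g⟫) - (y i - ⟪x i, β⟫)) +
          ((y i - ⟪x i, β + ε • g⟫) - (y i - ⟪x i, β⟫)) ^ 2) =
          ∑ i, rho τ (y i - ⟪x i, β⟫) + (-2 * ε * ⟪g, g⟫ + ε ^ 2 * C) := by
        rw [kg, hC, Finset.mul_sum, Finset.mul_sum, ← Finset.sum_add_distrib,
          ← Finset.sum_add_distrib]
        refine Finset.sum_congr rfl fun i _ => ?_
        rw [inner_add_right, real_inner_smul_right]
        ring
      linarith
    have hm := main (⟪g, g⟫ / (C + 1))
    have hpos : 0 < C + 1 := by linarith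
    have e : -2 * (⟪g, g⟫ / (C + 1)) * ⟪g, g⟫ + (⟪g, g⟫ / (C + 1)) ^ 2 * C =
        -(⟪g, g⟫ / (C + 1)) ^ 2 * (C + 2) := by
      field_simp
      ring
    rw [e] at hm
    have h5 : (⟪g, g⟫ / (C + 1)) ^ 2 = 0 := by
      nlinarith [sq_nonneg (⟪g, g⟫ / (C + 1)), mul_nonneg (sq_nonneg (⟪g, g⟫ / (C + 1))) hC0]
    have h6 : ⟪g, g⟫ = 0 := by
      rcases div_eq_zero_iff.1 (pow_eq_zero_iff two_ne_zero |>.1 h5) with h | h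
      · exact h
      · linarith
    exact inner_self_eq_zero.1 h6
  · intro h β'
    have k := key (β - β')
    rw [h, inner_zero_left] at k
    have h2 := Finset.sum_le_sum fun i (_ : i ∈ Finset.univ) =>
        rho_lower_s15 τ h0 h1 (y i - ⟪x i, β⟫) (y i - ⟪x i, β'⟫)
    have h3 : ∑ i, (rho τ (y i - ⟪x i, β⟫) + 2 * (psi τ (y i - ⟪x i, β⟫) * (y i - ⟪x i, β⟫)) *
          ((y i - ⟪x i, β'⟫) - (y i - ⟪x i, β⟫))) = ∑ i, rho τ (y i - ⟪x i, β⟫) +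
          2 * ∑ i, (psi τ (y i - ⟪x i, β⟫) * (y i - ⟪x i, β⟫)) * ⟪x i, β - β'⟫ := by
      rw [Finset.mul_sum, ← Finset.sum_add_distrib]
      refine Finset.sum_congr rfl fun i _ => ?_
      rw [inner_sub_right]
      ring
    linarith
end

section
/- Let τ ∈ (0,1), m ∈ ℝ and σ > 0, and define the asymmetric normal density f(u) = (2/√(πσ²)) · (√(τ(1−τ))/(√τ + √(1−τ))) · exp(−ρ_τ((u − m)/σ)). Then ∫_ℝ ψ_τ(u − m)·(u − m)·f(u) du = 0; that is, the location parameter m is the τ-expectile of the asymmetric normal distribution AND(m, σ², τ), so a random error with this distribution is centered on its τ-th expectile. -/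
open MeasureTheory

/-- The asymmetric normal density `AND(m, σ², τ)`. -/
noncomputable def andDensity (τ m σ u : ℝ) : ℝ :=
  2 / Real.sqrt (Real.pi * σ ^ 2) *
    (Real.sqrt (τ * (1 - τ)) / (Real.sqrt τ + Real.sqrt (1 - τ))) *
    Real.exp (-rho τ ((u - m) / σ))

lemma aux_hasDeriv (C s a x : ℝ) (hs : s ≠ 0) :
    HasDerivAt (fun t : ℝ => -(C * s ^ 2 / 2) * Real.exp (-(a * (t / s) ^ 2)))
      (a * x * (C * Real.exp (-(a * (x / s) ^ 2)))) x := by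
  have h1 : HasDerivAt (fun t : ℝ => -(a * (t / s) ^ 2)) (-(a * (2 * (x / s) * (1 / s)))) x := by
    have := ((((hasDerivAt_id x).div_const s).pow 2).const_mul a).neg
    refine this.congr_deriv ?_
    simp
  refine (h1.exp.const_mul (-(C * s ^ 2 / 2))).congr_deriv ?_
  field_simp

lemma aux_tendsto (C s a : ℝ) (hs : 0 < s) (ha : 0 < a) (l : Filter ℝ)
    (hl : Filter.Tendsto (fun t : ℝ => t ^ 2) l Filter.atTop) :
    Filter.Tendsto (fun t : ℝ => -(C * s ^ 2 / 2) * Real.exp (-(a * (t / s) ^ 2))) l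
      (nhds 0) := by
  have h2 : Filter.Tendsto (fun t : ℝ => a * (t / s) ^ 2) l Filter.atTop := by
    have := hl.const_mul_atTop (show 0 < a / s ^ 2 by positivity)
    refine this.congr fun t => ?_
    field_simp
  have := (Real.tendsto_exp_neg_atTop_nhds_zero.comp h2).const_mul (-(C * s ^ 2 / 2))
  simpa using this

/-- The location parameter `m` is the `τ`-expectile of the asymmetric normal distribution
`AND(m, σ², τ)`: `∫ ψ_τ(u − m)·(u − m)·f(u) du = 0`, i.e. a random error with this
distribution is centered on its `τ`-th expectile. -/
theorem andDensity_centered_on_expectile (τ : ℝ) (hτ : τ ∈ Set.Ioo (0 : ℝ) 1)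
    (m σ : ℝ) (hσ : 0 < σ) :
    (∫ u : ℝ, psi τ (u - m) * (u - m) * andDensity τ m σ u) = 0 := by
  obtain ⟨h0, h1⟩ := hτ
  have h1' : 0 < 1 - τ := by linarith
  unfold andDensity
  set C := 2 / Real.sqrt (Real.pi * σ ^ 2) *
    (Real.sqrt (τ * (1 - τ)) / (Real.sqrt τ + Real.sqrt (1 - τ))) with hC
  rw [integral_sub_right_eq_self
    (fun t : ℝ => psi τ t * t * (C * Real.exp (-rho τ (t / σ)))) m]
  by_cases hi : Integrable (fun t : ℝ => psi τ t * t * (C * Real.exp (-rho τ (t / σ))))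
  swap
  · exact integral_undef hi
  have eI : Set.EqOn (fun t : ℝ => psi τ t * t * (C * Real.exp (-rho τ (t / σ))))
      (fun t => (1 - τ) * t * (C * Real.exp (-((1 - τ) * (t / σ) ^ 2)))) (Set.Iic 0) := by
    intro t ht
    have ht' : t / σ ≤ 0 := div_nonpos_of_nonpos_of_nonneg ht hσ.le
    simp only [Set.mem_Iic] at ht
    simp [rho, psi, ht, ht']
  have eJ : Set.EqOn (fun t : ℝ => psi τ t * t * (C * Real.exp (-rho τ (t / σ))))
      (fun t => τ * t * (C * Real.exp (-(τ * (t / σ) ^ 2)))) (Set.Ioi 0) := by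
    intro t ht
    have ht' : 0 < t / σ := div_pos ht hσ
    simp only [Set.mem_Ioi] at ht
    simp [rho, psi, not_le.2 ht, not_le.2 ht']
  rw [← intervalIntegral.integral_Iic_add_Ioi (b := 0) hi.integrableOn hi.integrableOn,
    setIntegral_congr_fun measurableSet_Iic eI, setIntegral_congr_fun measurableSet_Ioi eJ,
    integral_Iic_of_hasDerivAt_of_tendsto' (fun x _ => aux_hasDeriv C σ (1 - τ) x hσ.ne')
      (hi.integrableOn.congr_fun eI measurableSet_Iic)
      (aux_tendsto C σ (1 - τ) hσ h1' _ (by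
        simpa using (Filter.tendsto_pow_atTop (α := ℝ) two_ne_zero).comp
          Filter.tendsto_abs_atBot_atTop |>.congr (fun x => by simp))),
    integral_Ioi_of_hasDerivAt_of_tendsto' (fun x _ => aux_hasDeriv C σ τ x hσ.ne')
      (hi.integrableOn.congr_fun eJ measurableSet_Ioi)
      (aux_tendsto C σ τ hσ h0 _ (Filter.tendsto_pow_atTop two_ne_zero))]
  simp
end

section
/- (Basic Corollary of Hjort.) Let (Ω, F, P) be a probability space, d ≥ 1, and let V be a symmetric positive definite real d×d matrix. For each n, let A_n : Ω × ℝ^d → ℝ be such that for P-almost every ω the map s ↦ A_n(ω, s) is convex, and suppose A_n(ω, s) = (1/2)·sᵀVs + ⟪U_n(ω), s⟫ + C_n(ω) + r_n(ω, s), where U_n : Ω → ℝ^d is measurable and stochastically bounded (for every ε > 0 there exists M > 0 with P(‖U_n‖ > M) ≤ ε for all n), C_n : Ω → ℝ is measurable, and for each fixed s ∈ ℝ^d, r_n(·, s) → 0 in probability as n → ∞. Let α_n : Ω → ℝ^d be measurable with A_n(ω, α_n(ω)) ≤ A_n(ω, s) for all s ∈ ℝ^d (i.e., α_n is a minimizer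 of A_n(ω, ·)). Then ‖α_n − (−V⁻¹U_n)‖ → 0 in probability; moreover, if U_n converges in distribution to a random vector U, then α_n converges in distribution to −V⁻¹U. -/
open MeasureTheory Filter
open scoped RealInnerProductSpace ENNReal

/-- A closed ball lies in the convex hull of a finite set. -/
lemma hjort_hull (d : ℕ) (R : ℝ) :
    ∃ T : Set (EuclideanSpace ℝ (Fin d)), T.Finite ∧
      Metric.closedBall 0 R ⊆ convexHull ℝ T := by
  let e : (Fin d → ℝ) →ₗ[ℝ] EuclideanSpace ℝ (Fin d) :=
    (WithLp.linearEquiv 2 ℝ (Fin d → ℝ)).symm.toLinearMap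
  refine ⟨e '' (Set.univ.pi fun _ => {-R, R}), (Set.Finite.pi fun _ => by simp).image _, ?_⟩
  intro x hx
  rw [← LinearMap.image_convexHull, convexHull_pi]
  refine ⟨WithLp.ofLp x, ?_, rfl⟩
  intro i _
  have h1 : ‖x i‖ ≤ ‖x‖ := PiLp.norm_apply_le x i
  have h2 : ‖x‖ ≤ R := by simpa using hx
  rw [Real.norm_eq_abs] at h1
  have h3 := abs_le.1 (h1.trans h2)
  rw [convexHull_pair, segment_eq_Icc (by linarith)]
  exact h3

/-- Convexity lemma: closeness at finitely many points gives uniform closeness on a ball. -/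
lemma hjort_unif (d : ℕ) (q : EuclideanSpace ℝ (Fin d) → ℝ) (hq : Continuous q)
    (R η : ℝ) (hη : 0 < η) :
    ∃ F : Set (EuclideanSpace ℝ (Fin d)), F.Finite ∧ ∃ δ : ℝ, 0 < δ ∧
      ∀ g : EuclideanSpace ℝ (Fin d) → ℝ, ConvexOn ℝ Set.univ g →
        (∀ s ∈ F, |g s - q s| < δ) → ∀ x, ‖x‖ ≤ R → |g x - q x| < η := by
  obtain ⟨T, hT, hTR⟩ := hjort_hull d (R + 2)
  have hF1 : (insert 0 T).Finite := hT.insert 0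
  obtain ⟨B0, hB0⟩ := (hF1.image fun s => |q s|).bddAbove
  have hB : ∀ s ∈ insert 0 T, |q s| ≤ B0 := fun s hs => hB0 ⟨s, hs, rfl⟩
  have hB0n : 0 ≤ B0 := (abs_nonneg _).trans (hB 0 (by simp))
  set B := 3 * (B0 + 1) with hBdef
  have hK : IsCompact (Metric.closedBall (0 : EuclideanSpace ℝ (Fin d)) R) :=
    isCompact_closedBall _ _
  obtain ⟨δ1, hδ1, hu⟩ := Metric.uniformContinuousOn_iff.1
    (hK.uniformContinuousOn_of_continuous hq.continuousOn) (η / 3) (by positivity)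
  set L := 2 * B with hL
  have hLp : 0 < L := by positivity
  obtain ⟨N, hNs, hN, hcov⟩ := hK.finite_cover_balls
    (e := min δ1 (η / (3 * L))) (by positivity)
  refine ⟨insert 0 T ∪ N, hF1.union hN, min 1 (η / 3), by positivity, ?_⟩
  intro g hg hgF x hx
  have hgB : ∀ s ∈ insert 0 T, |g s| ≤ B0 + 1 := by
    intro s hs
    have h1 := (hgF s (Or.inl hs)).trans_le (min_le_left _ _)
    have h2 := hB s hs
    have h3 : |g s| ≤ |g s - q s| + |q s| := by
      simpa using abs_add_le (g s - q s) (q s)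
    linarith
  have hup : ∀ y, ‖y‖ ≤ R + 2 → g y ≤ B0 + 1 := by
    intro y hy
    obtain ⟨z, hz, hyz⟩ := hg.exists_ge_of_mem_convexHull (Set.subset_univ T)
      (hTR (by simpa using hy))
    exact hyz.trans ((le_abs_self _).trans (hgB z (Or.inr hz)))
  have habs : ∀ y, dist y 0 < R + 2 → |g y| ≤ B := by
    intro y hy
    rw [dist_zero_right] at hy
    have h1 := hup y hy.le
    have h2 := hup (-y) (by simpa using hy.le)
    have h3 := hg.2 (Set.mem_univ y) (Set.mem_univ (-y)) (by norm_num : (0 : ℝ) ≤ 1 / 2)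
      (by norm_num : (0 : ℝ) ≤ 1 / 2) (by norm_num)
    have h4 := (abs_le.1 (hgB 0 (by simp))).1
    simp only [smul_neg, add_neg_cancel, smul_eq_mul] at h3
    rw [abs_le]
    constructor <;> linarith
  have hlip := (hg.subset (Set.subset_univ _) (convex_ball 0 (R + 2))).lipschitzOnWith_of_abs_le
    one_pos habs
  obtain ⟨y, hyN, hxy⟩ : ∃ y ∈ N, dist x y < min δ1 (η / (3 * L)) := by
    have := hcov (show x ∈ Metric.closedBall 0 R by simpa using hx)
    simp only [Set.mem_iUnion, Metric.mem_ball, exists_prop] at this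
    exact this
  have hyR : ‖y‖ ≤ R := by simpa using hNs hyN
  have e1 : |q x - q y| < η / 3 := by
    have := hu x (by simpa using hx) y (by simpa using hyR) (hxy.trans_le (min_le_left _ _))
    rwa [Real.dist_eq] at this
  have e2 : |g x - g y| < η / 3 := by
    have h := hlip.dist_le_mul x (by simp; linarith) y (by simp; linarith)
    rw [Real.dist_eq, div_one, Real.coe_toNNReal _ hLp.le] at h
    have h5 := hxy.trans_le (min_le_right _ _)
    calc _ ≤ _ := h
      _ < L * (η / (3 * L)) := by gcongr
      _ = η / 3 := by field_simp
  have e3 := (hgF y (Or.inr hyN)).trans_le (min_le_right _ _)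
  rw [abs_lt] at *
  constructor <;> linarith [e1.1, e1.2, e2.1, e2.2, e3.1, e3.2]

/-- Deterministic core of the corollary. -/
lemma hjort_det (d : ℕ)
    (V S : EuclideanSpace ℝ (Fin d) →ₗ[ℝ] EuclideanSpace ℝ (Fin d))
    (hsym : V.IsSymmetric) (hpos : ∀ x, x ≠ 0 → 0 < ⟪x, V x⟫) (hVS : ∀ u, V (S u) = u)
    (M ε : ℝ) (hε : 0 < ε) :
    ∃ F : Set (EuclideanSpace ℝ (Fin d)), F.Finite ∧ ∃ δ : ℝ, 0 < δ ∧
      ∀ (A r : EuclideanSpace ℝ (Fin d) → ℝ) (u a : EuclideanSpace ℝ (Fin d)) (c : ℝ),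
        ConvexOn ℝ Set.univ A →
        (∀ s, A s = 1 / 2 * ⟪s, V s⟫ + ⟪u, s⟫ + c + r s) →
        ‖u‖ ≤ M → (∀ s ∈ F, |r s| < δ) → (∀ s, A a ≤ A s) → ‖a - (-(S u))‖ < ε := by
  have hVc : Continuous V := V.continuous_of_finiteDimensional
  have hqc : Continuous fun s : EuclideanSpace ℝ (Fin d) => ⟪s, V s⟫ :=
    continuous_id.inner hVc
  obtain ⟨m, hm, hmle⟩ := (isCompact_sphere (0 : EuclideanSpace ℝ (Fin d)) ε).exists_forall_le'
    (a := (0 : ℝ)) hqc.continuousOn (fun b hb => hpos b (by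
      rintro rfl
      simp at hb
      linarith))
  let S' := LinearMap.toContinuousLinearMap S
  obtain ⟨F, hF, δ, hδ, h⟩ := hjort_unif d (fun s => 1 / 2 * ⟪s, V s⟫) (by fun_prop)
    (‖S'‖ * M + ε) (m / 8) (by positivity)
  refine ⟨F, hF, δ, hδ, ?_⟩
  intro A r u a c hA hdec hu hrF hmin
  by_contra! hcon
  have hSu : ‖S u‖ ≤ ‖S'‖ * M := (S'.le_opNorm u).trans (by gcongr)
  set β := -(S u) with hβ
  have hVβ : V β = -u := by rw [hβ, map_neg, hVS]
  have hβn : ‖β‖ ≤ ‖S'‖ * M := by rw [hβ, norm_neg]; exact hSu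
  clear_value β
  have hg : ConvexOn ℝ Set.univ (fun s => 1 / 2 * ⟪s, V s⟫ + r s) := by
    have h1 : ConvexOn ℝ Set.univ (fun s => A s + (-(innerSL ℝ u).toLinearMap) s + (-c)) :=
      (hA.add (LinearMap.convexOn _ convex_univ)).add (convexOn_const _ convex_univ)
    convert h1 using 2 with s
    rw [hdec]
    simp
    ring
  have hr := h _ hg (by simpa using hrF)
  simp only [add_sub_cancel_left] at hr
  set t := ε / ‖a - β‖ with ht
  have hnp : 0 < ‖a - β‖ := hε.trans_le hcon
  have ht0 : 0 ≤ t := by positivity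
  have ht1 : t ≤ 1 := by rw [ht, div_le_one hnp]; exact hcon
  set k := t • (a - β) with hk
  have hkn : ‖k‖ = ε := by
    rw [hk, norm_smul, Real.norm_of_nonneg ht0, ht]
    field_simp
  have hle : A (β + k) ≤ A β := by
    have h1 := hA.2 (Set.mem_univ β) (Set.mem_univ a) (sub_nonneg.2 ht1)
      ht0 (by ring)
    have h2 : (1 - t) • β + t • a = β + k := by rw [hk]; module
    rw [h2, smul_eq_mul, smul_eq_mul] at h1
    nlinarith [hmin β]
  have hq := hmle k (by simpa using hkn)
  have r1 := abs_lt.1 (hr β (by linarith))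
  have r2 := abs_lt.1 (hr (β + k) ((norm_add_le _ _).trans (by linarith)))
  rw [hdec, hdec] at hle
  have hs : ⟪β, V k⟫ = ⟪V β, k⟫ := (hsym β k).symm
  have hc : ⟪k, u⟫ = ⟪u, k⟫ := real_inner_comm u k
  rw [map_add, inner_add_left, inner_add_right, inner_add_right, inner_add_right, hs, hVβ,
    inner_neg_left, inner_neg_right, inner_neg_right, hc] at hle
  linarith [r1.1, r1.2, r2.1, r2.2]

/-- **Basic Corollary of Hjort.** If the convex processes `A_n(ω, s)` admit the quadratic
decomposition `A_n(ω, s) = (1/2)·sᵀVs + ⟪U_n(ω), s⟫ + C_n(ω) + r_n(ω, s)` with `V`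
symmetric positive definite, `U_n` stochastically bounded and `r_n(·, s) → 0` in
probability for each `s`, then any sequence of minimizers `α_n` of `A_n(ω, ·)` satisfies
`‖α_n − (−V⁻¹U_n)‖ → 0` in probability; moreover if `U_n` converges in distribution to
a law `μ`, then `α_n` converges in distribution to the law of `−V⁻¹U`, `U ∼ μ`. -/
theorem hjort_basic_corollary
    {Ω : Type*} [MeasurableSpace Ω] (P : Measure Ω) [IsProbabilityMeasure P]
    (d : ℕ) (hd : 1 ≤ d)
    (V : Matrix (Fin d) (Fin d) ℝ) (hVsymm : V.IsSymm) (hVpos : V.PosDef)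
    (A : ℕ → Ω → EuclideanSpace ℝ (Fin d) → ℝ)
    (U : ℕ → Ω → EuclideanSpace ℝ (Fin d)) (hUmeas : ∀ n, Measurable (U n))
    (C : ℕ → Ω → ℝ) (hCmeas : ∀ n, Measurable (C n))
    (r : ℕ → Ω → EuclideanSpace ℝ (Fin d) → ℝ)
    (hconv : ∀ n, ∀ᵐ ω ∂P, ConvexOn ℝ Set.univ (A n ω))
    (hdecomp : ∀ n, ∀ ω, ∀ s : EuclideanSpace ℝ (Fin d),
      A n ω s = 1 / 2 * ⟪s, Matrix.toEuclideanLin V s⟫ + ⟪U n ω, s⟫ + C n ω + r n ω s)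
    (hUbdd : ∀ ε : ℝ, 0 < ε → ∃ M : ℝ, 0 < M ∧
      ∀ n, P {ω | M < ‖U n ω‖} ≤ ENNReal.ofReal ε)
    (hr : ∀ s : EuclideanSpace ℝ (Fin d), ∀ ε : ℝ, 0 < ε →
      Tendsto (fun n => P {ω | ε ≤ |r n ω s|}) atTop (nhds 0))
    (α : ℕ → Ω → EuclideanSpace ℝ (Fin d)) (hαmeas : ∀ n, Measurable (α n))
    (hαmin : ∀ n, ∀ ω, ∀ s : EuclideanSpace ℝ (Fin d), A n ω (α n ω) ≤ A n ω s) :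
    (∀ ε : ℝ, 0 < ε →
      Tendsto
        (fun n => P {ω | ε ≤ ‖α n ω - (-(Matrix.toEuclideanLin V⁻¹ (U n ω)))‖})
        atTop (nhds 0)) ∧
    (∀ μ : Measure (EuclideanSpace ℝ (Fin d)), IsProbabilityMeasure μ →
      (∀ f : BoundedContinuousFunction (EuclideanSpace ℝ (Fin d)) ℝ,
        Tendsto (fun n => ∫ ω, f (U n ω) ∂P) atTop (nhds (∫ u, f u ∂μ))) →
      ∀ f : BoundedContinuousFunction (EuclideanSpace ℝ (Fin d)) ℝ,
        Tendsto (fun n => ∫ ω, f (α n ω) ∂P) atTop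
          (nhds (∫ u, f (-(Matrix.toEuclideanLin V⁻¹ u)) ∂μ))) := by
  have hsym : (Matrix.toEuclideanLin V).IsSymmetric :=
    Matrix.isSymmetric_toEuclideanLin_iff.2 hVpos.isHermitian
  have hVS : ∀ u, Matrix.toEuclideanLin V (Matrix.toEuclideanLin V⁻¹ u) = u := by
    intro u
    have hdet : IsUnit V.det := (Matrix.isUnit_iff_isUnit_det V).1 hVpos.isUnit
    simp [Matrix.toLpLin_apply, Matrix.mulVec_mulVec, Matrix.mul_nonsing_inv V hdet]
  have hpos : ∀ x : EuclideanSpace ℝ (Fin d), x ≠ 0 → 0 < ⟪x, Matrix.toEuclideanLin V x⟫ := by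
    intro x hx
    have h := hVpos.dotProduct_mulVec_pos (x := WithLp.ofLp x) (by simpa using hx)
    rw [EuclideanSpace.inner_eq_star_dotProduct, dotProduct_comm]
    simpa using h
  have part1 : ∀ ε : ℝ, 0 < ε →
      Tendsto
        (fun n => P {ω | ε ≤ ‖α n ω - (-(Matrix.toEuclideanLin V⁻¹ (U n ω)))‖})
        atTop (nhds 0) := by
    intro ε hε
    rw [ENNReal.tendsto_nhds_zero]
    intro η hη
    obtain ⟨η', hη', hη'le⟩ : ∃ x : ℝ, 0 < x ∧ ENNReal.ofReal x ≤ η / 2 := by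
      obtain ⟨x, hx0, hx⟩ := ENNReal.lt_iff_exists_nnreal_btwn.1 (ENNReal.half_pos hη.ne')
      exact ⟨x, by exact_mod_cast hx0, by simpa using hx.le⟩
    obtain ⟨M, hM, hUM⟩ := hUbdd η' hη'
    obtain ⟨F, hF, δ, hδ, hdet⟩ := hjort_det d (Matrix.toEuclideanLin V)
      (Matrix.toEuclideanLin V⁻¹) hsym hpos hVS M ε hε
    have hsum : Tendsto (fun n => ∑ s ∈ hF.toFinset, P {ω | δ ≤ |r n ω s|}) atTop (nhds 0) := by
      simpa using tendsto_finsetSum hF.toFinset (fun s _ => hr s δ hδ)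
    filter_upwards [(ENNReal.tendsto_nhds_zero.1 hsum) (η / 2) (ENNReal.half_pos hη.ne')]
      with n hn
    have hsub : {ω | ε ≤ ‖α n ω - (-(Matrix.toEuclideanLin V⁻¹ (U n ω)))‖} ⊆
        ({ω | M < ‖U n ω‖} ∪ ⋃ s ∈ hF.toFinset, {ω | δ ≤ |r n ω s|}) ∪
          {ω | ¬ ConvexOn ℝ Set.univ (A n ω)} := by
      intro ω hω
      by_contra hc
      simp only [Set.mem_union, Set.mem_ofPred_eq, Set.mem_iUnion, Set.Finite.mem_toFinset,
        not_or, not_exists, not_lt, not_le, not_not] at hc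
      obtain ⟨⟨h1, h2⟩, h3⟩ := hc
      exact absurd (hdet (A n ω) (r n ω) (U n ω) (α n ω) (C n ω) h3 (hdecomp n ω) h1 h2
        (hαmin n ω)) (not_lt.2 hω)
    calc _ ≤ _ := measure_mono hsub
      _ ≤ (P {ω | M < ‖U n ω‖} + ∑ s ∈ hF.toFinset, P {ω | δ ≤ |r n ω s|}) +
          P {ω | ¬ ConvexOn ℝ Set.univ (A n ω)} :=
        (measure_union_le _ _).trans (add_le_add
          ((measure_union_le _ _).trans (add_le_add le_rfl (measure_biUnion_finset_le _ _))) le_rfl)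
      _ ≤ (η / 2 + η / 2) + 0 :=
        add_le_add (add_le_add ((hUM n).trans hη'le) hn) (ae_iff.1 (hconv n)).le
      _ = η := by rw [add_zero, ENNReal.add_halves]
  refine ⟨part1, ?_⟩
  intro μ hμ hU f
  have hVc : Continuous fun u : EuclideanSpace ℝ (Fin d) => -(Matrix.toEuclideanLin V⁻¹ u) :=
    (LinearMap.continuous_of_finiteDimensional _).neg
  have hD : TendstoInDistribution U atTop (id : EuclideanSpace ℝ (Fin d) → _) (fun _ => P) μ := by
    refine ⟨fun n => (hUmeas n).aemeasurable, aemeasurable_id, ?_⟩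
    refine ProbabilityMeasure.tendsto_iff_forall_integral_tendsto.2 ?_
    intro f
    have h := hU f
    simp only [ProbabilityMeasure.coe_mk, Measure.map_id]
    refine h.congr fun n => ?_
    exact (integral_map (hUmeas n).aemeasurable f.continuous.aestronglyMeasurable).symm
  have hD2 := tendstoInDistribution_of_tendstoInMeasure_sub α _ (hD.continuous_comp hVc)
    (by
      rw [tendstoInMeasure_iff_norm]
      intro ε hε
      simpa using part1 ε hε)
    (fun n => (hαmeas n).aemeasurable)
  have h := (ProbabilityMeasure.tendsto_iff_forall_integral_tendsto.1 hD2.tendsto) f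
  simp only [ProbabilityMeasure.coe_mk, Function.comp_id] at h
  rw [integral_map hVc.measurable.aemeasurable f.continuous.aestronglyMeasurable] at h
  refine h.congr fun n => ?_
  exact integral_map (hαmeas n).aemeasurable f.continuous.aestronglyMeasurable
end
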